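/- arXiv:2002.02731 — 3 statements merged into one kernel-verified Lean document; each statement's English description precedes it below -/
import Mathlib

section
/- Fix an integer b ≥ 2. Let n be a positive integer and let L be the number of digits of n in base b (so b^{L−1} ≤ n < b^L; in Lean L = (Nat.digits b n).length). Then for every integer i ≥ 0, the number (n + 1)·(b^{L+i} − 1) is sturdy in base b. (This number is the one whose base-b representation is x (b−1)^i x̄, where x is the base-b representation of n and x̄ is its digitwise complement.) -/
theorem sum_digits_mul_add {b : ℕ} (hb : 2 ≤ b) (q : ℕ) {r : ℕ} (hr : r < b) :
    (Nat.digits b (b * q + r)).sum = (Nat.digits b q).sum + r := by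
  by_cases h : r = 0 ∧ q = 0
  · simp [h.1, h.2]
  · rw [add_comm (b * q), Nat.digits_add b hb r q hr (by tauto), List.sum_cons, add_comm]

theorem sum_digits_pow_mul_add {b : ℕ} (hb : 2 ≤ b) (m q : ℕ) {r : ℕ} (hr : r < b ^ m) :
    (Nat.digits b (b ^ m * q + r)).sum = (Nat.digits b q).sum + (Nat.digits b r).sum := by
  induction m generalizing r with
  | zero =>
    obtain rfl : r = 0 := by simpa using hr
    simp
  | succ m ih =>
    have hmod : r % b < b := Nat.mod_lt _ (by lia)
    have hdiv : r / b < b ^ m := Nat.div_lt_of_lt_mul (by rwa [← pow_succ'])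
    have hr' : b * (r / b) + r % b = r := Nat.div_add_mod r b
    have key : b ^ (m + 1) * q + r = b * (b ^ m * q + r / b) + r % b := by
      rw [mul_add, add_assoc, hr']; ring
    have h := sum_digits_mul_add hb (r / b) hmod
    rw [hr'] at h
    rw [key, sum_digits_mul_add hb _ hmod, ih hdiv, h, add_assoc]

theorem sum_digits_succ_le {b : ℕ} (hb : 2 ≤ b) (x : ℕ) :
    (Nat.digits b (x + 1)).sum ≤ (Nat.digits b x).sum + 1 := by
  induction x using Nat.strong_induction_on with
  | _ x ih =>
    have hmod : x % b < b := Nat.mod_lt _ (by lia)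
    have hx : b * (x / b) + x % b = x := Nat.div_add_mod x b
    have h := sum_digits_mul_add hb (x / b) hmod
    rw [hx] at h
    by_cases hc : x % b + 1 < b
    · have h' := sum_digits_mul_add hb (x / b) hc
      rw [← add_assoc, hx] at h'
      lia
    · have h' := sum_digits_mul_add hb (x / b + 1) (r := 0) (by lia)
      have key : b * (x / b + 1) + 0 = x + 1 := by rw [mul_add]; lia
      rw [key] at h'
      have := ih (x / b) (Nat.div_lt_self (by lia) hb)
      lia

theorem sum_digits_add_le {b : ℕ} (hb : 2 ≤ b) (x y : ℕ) :
    (Nat.digits b (x + y)).sum ≤ (Nat.digits b x).sum + (Nat.digits b y).sum := by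
  induction x using Nat.strong_induction_on generalizing y with
  | _ x ih =>
    rcases Nat.eq_zero_or_pos x with rfl | hpos
    · simp
    have hxmod : x % b < b := Nat.mod_lt _ (by lia)
    have hymod : y % b < b := Nat.mod_lt _ (by lia)
    have hx : b * (x / b) + x % b = x := Nat.div_add_mod x b
    have hy : b * (y / b) + y % b = y := Nat.div_add_mod y b
    have h1 := sum_digits_mul_add hb (x / b) hxmod
    have h2 := sum_digits_mul_add hb (y / b) hymod
    rw [hx] at h1
    rw [hy] at h2
    have hlt : x / b < x := Nat.div_lt_self hpos hb
    by_cases hc : x % b + y % b < b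
    · have h := sum_digits_mul_add hb (x / b + y / b) hc
      have key : b * (x / b + y / b) + (x % b + y % b) = x + y := by rw [mul_add]; lia
      rw [key] at h
      have := ih _ hlt (y / b)
      lia
    · have h := sum_digits_mul_add hb (x / b + (y / b + 1)) (r := x % b + y % b - b) (by lia)
      have key : b * (x / b + (y / b + 1)) + (x % b + y % b - b) = x + y := by
        rw [mul_add, mul_add]; lia
      rw [key] at h
      have := ih _ hlt (y / b + 1)
      have := sum_digits_succ_le hb (y / b)
      lia

theorem sum_digits_add_sum_digits_compl {b : ℕ} (hb : 2 ≤ b) (m : ℕ) {r : ℕ} (hr : r < b ^ m) :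
    (Nat.digits b r).sum + (Nat.digits b (b ^ m - 1 - r)).sum = m * (b - 1) := by
  induction m generalizing r with
  | zero =>
    obtain rfl : r = 0 := by simpa using hr
    simp
  | succ m ih =>
    have hmod : r % b < b := Nat.mod_lt _ (by lia)
    have hdiv : r / b < b ^ m := Nat.div_lt_of_lt_mul (by rwa [← pow_succ'])
    have hr' : b * (r / b) + r % b = r := Nat.div_add_mod r b
    have h := sum_digits_mul_add hb (r / b) hmod
    rw [hr'] at h
    have h' := sum_digits_mul_add hb (b ^ m - 1 - r / b) (r := b - 1 - r % b) (by lia)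
    have key : b * (b ^ m - 1 - r / b) + (b - 1 - r % b) = b ^ (m + 1) - 1 - r := by
      obtain ⟨c, hc⟩ : ∃ c, b ^ m = r / b + 1 + c := Nat.exists_eq_add_of_le hdiv
      have hc' : b ^ m - 1 - r / b = c := by lia
      rw [hc', pow_succ', hc, mul_add, mul_add, mul_one]
      lia
    rw [key] at h'
    have := ih hdiv
    rw [add_mul, one_mul]
    lia

/-- Every positive multiple of `b ^ m - 1` has base-`b` digit sum at least `m * (b - 1)`. -/
theorem le_sum_digits_of_pow_sub_one_dvd {b : ℕ} (hb : 2 ≤ b) (m : ℕ) {x : ℕ} (hx : 0 < x)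
    (hdvd : b ^ m - 1 ∣ x) : m * (b - 1) ≤ (Nat.digits b x).sum := by
  induction x using Nat.strong_induction_on with
  | _ x ih =>
    rcases Nat.eq_zero_or_pos m with rfl | hm
    · simp
    have hpow : 1 < b ^ m := Nat.one_lt_pow hm.ne' hb
    by_cases hlt : x < b ^ m
    · have hle := Nat.le_of_dvd hx hdvd
      have hcompl := sum_digits_add_sum_digits_compl hb m hlt
      have hzero : b ^ m - 1 - x = 0 := by lia
      simp only [hzero, Nat.digits_zero, List.sum_nil, add_zero] at hcompl
      exact hcompl.ge
    · have hmod : x % b ^ m < b ^ m := Nat.mod_lt _ (by lia)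
      have hx' : b ^ m * (x / b ^ m) + x % b ^ m = x := Nat.div_add_mod x _
      have hq : 0 < x / b ^ m := Nat.div_pos (by lia) (by lia)
      have hsum := sum_digits_pow_mul_add hb m (x / b ^ m) hmod
      rw [hx'] at hsum
      have hsplit : x = (b ^ m - 1) * (x / b ^ m) + (x / b ^ m + x % b ^ m) := by
        rw [← add_assoc, ← Nat.succ_mul, Nat.succ_eq_add_one, Nat.sub_add_cancel hpow.le, hx']
      have hfold : b ^ m - 1 ∣ x / b ^ m + x % b ^ m :=
        (Nat.dvd_add_right (dvd_mul_right _ (x / b ^ m))).1 (hsplit ▸ hdvd)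
      have hpos : 0 < (b ^ m - 1) * (x / b ^ m) := Nat.mul_pos (by lia) hq
      have := ih (x / b ^ m + x % b ^ m) (by lia) (by lia) hfold
      have := sum_digits_add_le hb (x / b ^ m) (x % b ^ m)
      lia

theorem sum_digits_succ_mul_pow_sub_one {b : ℕ} (hb : 2 ≤ b) {m n : ℕ} (hn : n < b ^ m) :
    (Nat.digits b ((n + 1) * (b ^ m - 1))).sum = m * (b - 1) := by
  have key : (n + 1) * (b ^ m - 1) = b ^ m * n + (b ^ m - 1 - n) := by
    obtain ⟨c, hc⟩ : ∃ c, b ^ m = n + 1 + c := Nat.exists_eq_add_of_le hn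
    have h1 : b ^ m - 1 = n + c := by lia
    rw [h1, hc, Nat.add_sub_cancel_left]
    ring
  rw [key, sum_digits_pow_mul_add hb m n (by lia), sum_digits_add_sum_digits_compl hb m hn]

theorem stmt_7 (b n : ℕ) (hb : 2 ≤ b) (hn : 1 ≤ n)
    (L : ℕ) (hL : L = (Nat.digits b n).length) :
    ∀ i : ℕ, ∀ k : ℕ, 1 ≤ k →
      (Nat.digits b ((n + 1) * (b ^ (L + i) - 1))).sum ≤
        (Nat.digits b (k * ((n + 1) * (b ^ (L + i) - 1)))).sum := by
  intro i k hk
  have hlt : n < b ^ (L + i) :=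
    (hL ▸ Nat.lt_base_pow_length_digits hb : n < b ^ L).trans_le
      (Nat.pow_le_pow_right (by lia) (Nat.le_add_right L i))
  rw [sum_digits_succ_mul_pow_sub_one hb hlt]
  refine le_sum_digits_of_pow_sub_one_dvd hb (L + i) ?_
    (Dvd.dvd.mul_left (dvd_mul_left _ _) _)
  exact Nat.mul_pos hk (Nat.mul_pos n.succ_pos (by lia))
end

section
/- Let b ≥ 2 be an integer and let m be a positive integer such that m² divides b − 1. Then for every positive integer N, the number (b^N − 1)²/m² is sturdy in base b. -/
theorem digits_sum_eq_mod_add_div {b : ℕ} (hb : 2 ≤ b) (n : ℕ) :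
    (Nat.digits b n).sum = n % b + (Nat.digits b (n / b)).sum := by
  rcases Nat.eq_zero_or_pos n with rfl | hn
  · simp
  · rw [Nat.digits_def' hb hn, List.sum_cons]

theorem digits_sum_mul_add {b : ℕ} (hb : 2 ≤ b) (y : ℕ) {d : ℕ} (hd : d < b) :
    (Nat.digits b (b * y + d)).sum = d + (Nat.digits b y).sum := by
  rw [digits_sum_eq_mod_add_div hb, Nat.mul_add_mod, Nat.mod_eq_of_lt hd,
    Nat.mul_add_div (by omega), Nat.div_eq_of_lt hd, Nat.add_zero]

theorem digits_sum_pow_mul_add {b : ℕ} (hb : 2 ≤ b) (y : ℕ) (N : ℕ) {x : ℕ} (hx : x < b ^ N) :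
    (Nat.digits b (b ^ N * y + x)).sum = (Nat.digits b y).sum + (Nat.digits b x).sum := by
  induction N generalizing x with
  | zero =>
    obtain rfl : x = 0 := by simpa using hx
    simp
  | succ N ih =>
    have hd : x / b < b ^ N := Nat.div_lt_of_lt_mul (by rwa [pow_succ'] at hx)
    have hr : x % b < b := Nat.mod_lt _ (by omega)
    have h : b ^ (N + 1) * y + x = b * (b ^ N * y + x / b) + x % b := by
      conv_lhs => rw [← Nat.div_add_mod x b]
      ring
    rw [h, digits_sum_mul_add hb _ hr, ih hd, digits_sum_eq_mod_add_div hb x]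
    ring

theorem digits_sum_add_digits_sum_of_add_eq {b : ℕ} (hb : 2 ≤ b) (N : ℕ) {x y : ℕ}
    (h : x + y + 1 = b ^ N) :
    (Nat.digits b x).sum + (Nat.digits b y).sum = N * (b - 1) := by
  induction N generalizing x y with
  | zero =>
    obtain ⟨rfl, rfl⟩ : x = 0 ∧ y = 0 := by simpa using h
    simp
  | succ N ih =>
    have hx := Nat.div_add_mod x b
    have hy := Nat.div_add_mod y b
    have hxr : x % b < b := Nat.mod_lt _ (by omega)
    have hyr : y % b < b := Nat.mod_lt _ (by omega)
    rw [pow_succ'] at h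
    have h₁ : b * (x / b + y / b) + (x % b + y % b + 1) = b * b ^ N := by
      rw [mul_add]; omega
    have h₂ : b ∣ x % b + y % b + 1 :=
      (Nat.dvd_add_right (dvd_mul_right b _)).1 (h₁ ▸ dvd_mul_right b _)
    obtain ⟨c, hc⟩ := h₂
    have hc₁ : c = 1 := by
      have : 0 < c := Nat.pos_of_ne_zero (by rintro rfl; omega)
      have : c < 2 := by
        by_contra! hc'
        have := Nat.mul_le_mul_left b hc'
        omega
      omega
    subst hc₁
    have h₃ : x / b + y / b + 1 = b ^ N :=
      Nat.eq_of_mul_eq_mul_left (by omega : 0 < b) (by rw [mul_add]; omega)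
    have := ih h₃
    rw [digits_sum_eq_mod_add_div hb x, digits_sum_eq_mod_add_div hb y, add_mul]
    omega

theorem digits_sum_add_add_le {b : ℕ} (hb : 2 ≤ b) (x y : ℕ) {c : ℕ} (hc : c ≤ 1) :
    (Nat.digits b (x + y + c)).sum ≤ (Nat.digits b x).sum + (Nat.digits b y).sum + c := by
  induction x using Nat.strong_induction_on generalizing y c with
  | _ x ihx =>
    induction y using Nat.strong_induction_on generalizing c with
    | _ y ihy =>
      have hx := Nat.div_add_mod x b
      have hy := Nat.div_add_mod y b
      have hxr : x % b < b := Nat.mod_lt _ (by omega)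
      have hyr : y % b < b := Nat.mod_lt _ (by omega)
      have step : ∀ e ≤ 1, (Nat.digits b (x / b + y / b + e)).sum ≤
          (Nat.digits b (x / b)).sum + (Nat.digits b (y / b)).sum + e := by
        intro e he
        rcases Nat.eq_zero_or_pos x with rfl | hx0
        · rcases Nat.eq_zero_or_pos y with rfl | hy0
          · interval_cases e <;> simp [Nat.digits_of_lt b 1 one_ne_zero (by omega)]
          · simpa using ihy (y / b) (Nat.div_lt_self hy0 hb) he
        · exact ihx (x / b) (Nat.div_lt_self hx0 hb) (y / b) he
      rw [digits_sum_eq_mod_add_div hb x, digits_sum_eq_mod_add_div hb y]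
      by_cases h : x % b + y % b + c < b
      · have := step 0 (by omega)
        have e : x + y + c = b * (x / b + y / b + 0) + (x % b + y % b + c) := by
          rw [mul_add, mul_add]; omega
        rw [e, digits_sum_mul_add hb _ h]
        omega
      · have := step 1 le_rfl
        have e : x + y + c = b * (x / b + y / b + 1) + (x % b + y % b + c - b) := by
          rw [mul_add, mul_add]; omega
        rw [e, digits_sum_mul_add hb _ (by omega)]
        omega

theorem le_digits_sum_of_pow_sub_one_dvd {b : ℕ} (hb : 2 ≤ b) {N : ℕ} (hN : 1 ≤ N) {n : ℕ}
    (hn : 0 < n) (h : b ^ N - 1 ∣ n) : N * (b - 1) ≤ (Nat.digits b n).sum := by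
  have hB : 2 ≤ b ^ N := hb.trans (Nat.le_self_pow (by omega) b)
  induction n using Nat.strong_induction_on with
  | _ n ih =>
    by_cases hlt : n < b ^ N
    · have hle := Nat.le_of_dvd hn h
      simpa using (digits_sum_add_digits_sum_of_add_eq hb N
        (show 0 + n + 1 = b ^ N by omega)).ge
    · have hdiv := Nat.div_add_mod n (b ^ N)
      have hr : n % b ^ N < b ^ N := Nat.mod_lt _ (by omega)
      have hq : 0 < n / b ^ N := Nat.div_pos (by omega) (by omega)
      set q := n / b ^ N
      set r := n % b ^ N
      have e : n = (b ^ N - 1) * q + (q + r) := by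
        rw [Nat.sub_mul, one_mul]
        have := Nat.le_mul_of_pos_left q (show 0 < b ^ N by omega)
        omega
      have hpos : 0 < (b ^ N - 1) * q := Nat.mul_pos (by omega) hq
      have hd : b ^ N - 1 ∣ q + r := (Nat.dvd_add_right (dvd_mul_right _ q)).1 (e ▸ h)
      have hlt : q + r < n := by omega
      calc N * (b - 1) ≤ (Nat.digits b (q + r)).sum := ih _ hlt (Nat.add_pos_left hq r) hd
        _ ≤ (Nat.digits b q).sum + (Nat.digits b r).sum :=
            digits_sum_add_add_le hb q r (Nat.zero_le 1)
        _ = (Nat.digits b n).sum := by rw [← hdiv, digits_sum_pow_mul_add hb q N hr]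

theorem digits_sum_pow_sub_one_mul {b : ℕ} (hb : 2 ≤ b) {N t : ℕ} (ht : 0 < t) (htN : t ≤ b ^ N) :
    (Nat.digits b ((b ^ N - 1) * t)).sum = N * (b - 1) := by
  have e : (b ^ N - 1) * t = b ^ N * (t - 1) + (b ^ N - t) := by
    have := Nat.le_mul_of_pos_right (b ^ N) ht
    rw [Nat.sub_mul, Nat.mul_sub]
    omega
  rw [e, digits_sum_pow_mul_add hb _ N (by omega)]
  exact digits_sum_add_digits_sum_of_add_eq hb N (by omega)

theorem stmt_8 (b m : ℕ) (hb : 2 ≤ b) (hm : 0 < m) (hmdvd : m ^ 2 ∣ b - 1) :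
    ∀ N : ℕ, 1 ≤ N →
      ∀ k : ℕ, 1 ≤ k →
        (Nat.digits b ((b ^ N - 1) ^ 2 / m ^ 2)).sum ≤
          (Nat.digits b (k * ((b ^ N - 1) ^ 2 / m ^ 2))).sum := by
  intro N hN k hk
  have hB : 2 ≤ b ^ N := hb.trans (Nat.le_self_pow (by omega) b)
  have hdvd : m ^ 2 ∣ b ^ N - 1 := hmdvd.trans (Nat.sub_one_dvd_pow_sub_one b N)
  have ht : 0 < (b ^ N - 1) / m ^ 2 := Nat.div_pos (Nat.le_of_dvd (by omega) hdvd) (by positivity)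
  have htN : (b ^ N - 1) / m ^ 2 ≤ b ^ N := (Nat.div_le_self _ _).trans (Nat.sub_le _ _)
  rw [pow_two (b ^ N - 1), Nat.mul_div_assoc _ hdvd, digits_sum_pow_sub_one_mul hb ht htN]
  refine le_digits_sum_of_pow_sub_one_dvd hb hN ?_ ((dvd_mul_right _ _).mul_left k)
  exact Nat.mul_pos hk (Nat.mul_pos (by omega) ht)
end

section
/- Let n be an odd positive integer whose binary representation contains exactly two 0's (i.e., the list Nat.digits 2 n contains exactly two entries equal to 0). Then n is sturdy in base 2 if and only if n = 51 or n = 2^{i+3} + 2^{i+2} − 3 for some integer i ≥ 0 (the numbers with binary representation 1 0 1^i 0 1); every other such n is flimsy in base 2. -/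
theorem sum_digits_two_mul (m : ℕ) :
    (Nat.digits 2 (2 * m)).sum = (Nat.digits 2 m).sum := by
  rcases Nat.eq_zero_or_pos m with rfl | hm
  · simp
  · rw [Nat.digits_base_mul (by norm_num) hm]
    simp

theorem sum_digits_two_mul_add_one (m : ℕ) :
    (Nat.digits 2 (2 * m + 1)).sum = (Nat.digits 2 m).sum + 1 := by
  rw [Nat.digits_add_two_add_one 0 (2 * m), zero_add, show (2 * m + 1) / 2 = m by omega,
    show (2 * m + 1) % 2 = 1 by omega]
  simp [add_comm]

theorem sum_digits_two_shift (m c d : ℕ) (hd : d < 2 ^ m) :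
    (Nat.digits 2 (c * 2 ^ m + d)).sum = (Nat.digits 2 c).sum + (Nat.digits 2 d).sum := by
  induction m generalizing d with
  | zero =>
    obtain rfl : d = 0 := by simpa using hd
    simp
  | succ m ih =>
    rw [pow_succ] at hd
    obtain ⟨e, rfl | rfl⟩ := Nat.even_or_odd' d
    · rw [show c * 2 ^ (m + 1) + 2 * e = 2 * (c * 2 ^ m + e) by ring, sum_digits_two_mul,
        sum_digits_two_mul, ih e (by omega)]
    · rw [show c * 2 ^ (m + 1) + (2 * e + 1) = 2 * (c * 2 ^ m + e) + 1 by ring,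
        sum_digits_two_mul_add_one, sum_digits_two_mul_add_one, ih e (by omega), add_assoc]

theorem sum_digits_two_compl (m x y : ℕ) (h : x + y + 1 = 2 ^ m) :
    (Nat.digits 2 x).sum + (Nat.digits 2 y).sum = m := by
  induction m generalizing x y with
  | zero =>
    obtain ⟨rfl, rfl⟩ : x = 0 ∧ y = 0 := by
      rw [pow_zero] at h
      omega
    simp
  | succ m ih =>
    rw [pow_succ] at h
    obtain ⟨u, rfl | rfl⟩ := Nat.even_or_odd' x <;> obtain ⟨v, rfl | rfl⟩ := Nat.even_or_odd' y
    · omega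
    · rw [sum_digits_two_mul, sum_digits_two_mul_add_one]
      have := ih u v (by omega)
      omega
    · rw [sum_digits_two_mul, sum_digits_two_mul_add_one]
      have := ih u v (by omega)
      omega
    · omega

theorem sum_digits_two_succ_le (x : ℕ) :
    (Nat.digits 2 (x + 1)).sum ≤ (Nat.digits 2 x).sum + 1 := by
  induction x using Nat.strong_induction_on with
  | _ x ih =>
    obtain ⟨u, rfl | rfl⟩ := Nat.even_or_odd' x
    · rw [sum_digits_two_mul_add_one, sum_digits_two_mul]
    · rw [show 2 * u + 1 + 1 = 2 * (u + 1) by ring, sum_digits_two_mul_add_one,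
        sum_digits_two_mul]
      have := ih u (by omega)
      omega

theorem sum_digits_two_add_le (x y : ℕ) :
    (Nat.digits 2 (x + y)).sum ≤ (Nat.digits 2 x).sum + (Nat.digits 2 y).sum := by
  induction x using Nat.strong_induction_on generalizing y with
  | _ x ih =>
    rcases Nat.eq_zero_or_pos x with rfl | hx
    · simp
    obtain ⟨u, rfl | rfl⟩ := Nat.even_or_odd' x <;>
      obtain ⟨v, rfl | rfl⟩ := Nat.even_or_odd' y <;> have := ih u (by omega) v
    · rw [← mul_add]
      simpa only [sum_digits_two_mul] using this
    · rw [← add_assoc, ← mul_add]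
      simp only [sum_digits_two_mul, sum_digits_two_mul_add_one]
      omega
    · rw [show 2 * u + 1 + 2 * v = 2 * (u + v) + 1 by ring]
      simp only [sum_digits_two_mul, sum_digits_two_mul_add_one]
      omega
    · rw [show 2 * u + 1 + (2 * v + 1) = 2 * (u + v + 1) by ring]
      simp only [sum_digits_two_mul, sum_digits_two_mul_add_one]
      have := sum_digits_two_succ_le (u + v)
      omega

theorem le_sum_digits_two_of_mersenne_dvd (m N : ℕ) (hm : 0 < m) (hN : 0 < N)
    (h : 2 ^ m - 1 ∣ N) : m ≤ (Nat.digits 2 N).sum := by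
  induction N using Nat.strong_induction_on with
  | _ N ih =>
    have h2 : 2 ≤ 2 ^ m := by simpa using Nat.pow_le_pow_right (n := 2) (by norm_num) hm
    rcases Nat.lt_or_ge N (2 ^ m) with hlt | hge
    · have hle := Nat.le_of_dvd hN h
      have := sum_digits_two_compl m N 0 (by omega)
      simp at this
      omega
    · have hd : N % 2 ^ m < 2 ^ m := Nat.mod_lt _ (by omega)
      have hc : 0 < N / 2 ^ m := Nat.div_pos hge (by omega)
      have hNe : N / 2 ^ m * 2 ^ m + N % 2 ^ m = N := Nat.div_add_mod' N _
      have hs := sum_digits_two_shift m (N / 2 ^ m) (N % 2 ^ m) hd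
      rw [hNe] at hs
      generalize N / 2 ^ m = c at *
      generalize N % 2 ^ m = d at *
      have hfold : N = c * (2 ^ m - 1) + (c + d) := by
        rw [← hNe]
        obtain ⟨t, ht⟩ : ∃ t, 2 ^ m = t + 1 := ⟨2 ^ m - 1, by omega⟩
        rw [ht, Nat.add_sub_cancel]
        ring
      have hlt : c + d < N := by
        have : 2 * c ≤ c * 2 ^ m := by nlinarith
        omega
      have hdvd : 2 ^ m - 1 ∣ c + d := by
        rw [hfold] at h
        exact (Nat.dvd_add_right (Dvd.intro_left c rfl)).1 h
      have := ih (c + d) hlt (by omega) hdvd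
      have := sum_digits_two_add_le c d
      omega

/-- The least digit sum of a positive integer in each residue class modulo `51`. -/
def minDigitSumModFiftyOne (r : ℕ) : ℕ :=
  ([4, 1, 1, 2, 1, 2, 2, 2, 1, 2, 2, 3, 2, 1, 2, 2, 1, 2, 2, 3, 2, 2, 3, 3, 2, 3, 1, 2, 2,
    2, 2, 3, 1, 2, 2, 3, 2, 3, 3, 2, 2, 3, 2, 3, 3, 2, 3, 3, 2, 3, 3] : List ℕ).getD r 0

theorem minDigitSumModFiftyOne_le (N : ℕ) (hN : 0 < N) :
    minDigitSumModFiftyOne (N % 51) ≤ (Nat.digits 2 N).sum := by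
  have step : ∀ r < 51, minDigitSumModFiftyOne (2 * r % 51) ≤ minDigitSumModFiftyOne r ∧
      minDigitSumModFiftyOne ((2 * r + 1) % 51) ≤ minDigitSumModFiftyOne r + 1 := by decide
  induction N using Nat.strong_induction_on with
  | _ N ih =>
    obtain ⟨u, rfl | rfl⟩ := Nat.even_or_odd' N
    · have h1 := ih u (by omega) (by omega)
      have h2 := (step (u % 51) (Nat.mod_lt _ (by norm_num))).1
      rw [sum_digits_two_mul, show 2 * u % 51 = 2 * (u % 51) % 51 by omega]
      omega
    · rcases Nat.eq_zero_or_pos u with rfl | hu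
      · decide
      have h1 := ih u (by omega) hu
      have h2 := (step (u % 51) (Nat.mod_lt _ (by norm_num))).2
      rw [sum_digits_two_mul_add_one, show (2 * u + 1) % 51 = (2 * (u % 51) + 1) % 51 by omega]
      omega

theorem count_zero_digits_two_mul (m : ℕ) (hm : 0 < m) :
    (Nat.digits 2 (2 * m)).count 0 = (Nat.digits 2 m).count 0 + 1 := by
  rw [Nat.digits_base_mul (by norm_num) hm]
  simp

theorem count_zero_digits_two_mul_add_one (m : ℕ) :
    (Nat.digits 2 (2 * m + 1)).count 0 = (Nat.digits 2 m).count 0 := by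
  rw [Nat.digits_add_two_add_one 0 (2 * m), zero_add, show (2 * m + 1) / 2 = m by omega,
    show (2 * m + 1) % 2 = 1 by omega]
  simp

theorem exists_of_count_zero_eq_zero (n : ℕ) (h : (Nat.digits 2 n).count 0 = 0) :
    ∃ r, n + 1 = 2 ^ r ∧ (Nat.digits 2 n).sum = r := by
  induction n using Nat.strong_induction_on with
  | _ n ih =>
    rcases Nat.eq_zero_or_pos n with rfl | hn
    · exact ⟨0, by simp⟩
    obtain ⟨u, rfl | rfl⟩ := Nat.even_or_odd' n
    · rw [count_zero_digits_two_mul u (by omega)] at h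
      omega
    · rw [count_zero_digits_two_mul_add_one] at h
      obtain ⟨r, h1, h2⟩ := ih u (by omega) h
      exact ⟨r + 1, by rw [pow_succ]; omega, by rw [sum_digits_two_mul_add_one]; omega⟩

theorem exists_of_count_zero_eq_one (n : ℕ) (h : (Nat.digits 2 n).count 0 = 1) :
    ∃ q r, 0 < r ∧ n + 1 + 2 ^ q = 2 ^ (q + r + 1) ∧ (Nat.digits 2 n).sum = q + r := by
  induction n using Nat.strong_induction_on with
  | _ n ih =>
    rcases Nat.eq_zero_or_pos n with rfl | hn
    · simp at h
    obtain ⟨u, rfl | rfl⟩ := Nat.even_or_odd' n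
    · rw [count_zero_digits_two_mul u (by omega)] at h
      obtain ⟨r, h1, h2⟩ := exists_of_count_zero_eq_zero u (by omega)
      refine ⟨0, r, ?_, ?_, ?_⟩
      · rcases Nat.eq_zero_or_pos r with rfl | hr
        · simp at h1
          omega
        · exact hr
      · rw [zero_add, pow_succ]
        omega
      · rw [sum_digits_two_mul]
        omega
    · rw [count_zero_digits_two_mul_add_one] at h
      obtain ⟨q, r, hr, h1, h2⟩ := ih u (by omega) h
      refine ⟨q + 1, r, hr, ?_, ?_⟩
      · rw [show q + 1 + r + 1 = (q + r + 1) + 1 by ring, pow_succ, pow_succ]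
        omega
      · rw [sum_digits_two_mul_add_one]
        omega

theorem exists_of_count_zero_eq_two (n : ℕ) (h : (Nat.digits 2 n).count 0 = 2) :
    ∃ p q r, 0 < r ∧ n + 1 + 2 ^ p + 2 ^ (p + q + 1) = 2 ^ (p + q + r + 2) ∧
      (Nat.digits 2 n).sum = p + q + r := by
  induction n using Nat.strong_induction_on with
  | _ n ih =>
    rcases Nat.eq_zero_or_pos n with rfl | hn
    · simp at h
    obtain ⟨u, rfl | rfl⟩ := Nat.even_or_odd' n
    · rw [count_zero_digits_two_mul u (by omega)] at h
      obtain ⟨q, r, hr, h1, h2⟩ := exists_of_count_zero_eq_one u (by omega)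
      refine ⟨0, q, r, hr, ?_, ?_⟩
      · rw [zero_add, show q + r + 2 = (q + r + 1) + 1 by ring, pow_succ, pow_succ]
        omega
      · rw [sum_digits_two_mul]
        omega
    · rw [count_zero_digits_two_mul_add_one] at h
      obtain ⟨p, q, r, hr, h1, h2⟩ := ih u (by omega) h
      refine ⟨p + 1, q, r, hr, ?_, ?_⟩
      · rw [show p + 1 + q + r + 2 = (p + q + r + 2) + 1 by ring,
          show p + 1 + q + 1 = (p + q + 1) + 1 by ring, pow_succ, pow_succ, pow_succ]
        omega
      · rw [sum_digits_two_mul_add_one]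
        omega

/-- If `n + w = 2 ^ L` then `(k + 1) * n` is the concatenation of `k` and of the `L`-bit complement
of `(k + 1) * w - 1`. -/
theorem sum_digits_two_mul_of_add_eq_two_pow (k n w v L : ℕ) (hn : n + w = 2 ^ L)
    (hv : v + 1 = (k + 1) * w) (hle : v + 1 ≤ 2 ^ L) :
    (Nat.digits 2 ((k + 1) * n)).sum + (Nat.digits 2 v).sum = (Nat.digits 2 k).sum + L := by
  obtain ⟨d, hd⟩ := Nat.exists_eq_add_of_le hle
  have hkn : (k + 1) * n = k * 2 ^ L + d := by
    have h : (k + 1) * n + (k + 1) * w = (k + 1) * 2 ^ L := by rw [← mul_add, hn]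
    rw [add_mul k 1 (2 ^ L), one_mul] at h
    omega
  rw [hkn, sum_digits_two_shift L k d (by omega)]
  have := sum_digits_two_compl L v d (by omega)
  omega

theorem sturdy_three_mul_mersenne (i k : ℕ) (hk : 1 ≤ k) :
    (Nat.digits 2 (2 ^ (i + 3) + 2 ^ (i + 2) - 3)).sum ≤
      (Nat.digits 2 (k * (2 ^ (i + 3) + 2 ^ (i + 2) - 3))).sum := by
  have h4 : 4 ≤ 2 ^ (i + 2) := by
    have := Nat.one_le_two_pow (n := i)
    rw [pow_add]
    omega
  have hmul : 2 ^ (i + 3) + 2 ^ (i + 2) - 3 = 3 * (2 ^ (i + 2) - 1) := by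
    rw [pow_succ 2 (i + 2)]
    omega
  have hsum : (Nat.digits 2 (2 ^ (i + 3) + 2 ^ (i + 2) - 3)).sum = i + 2 := by
    rw [show 2 ^ (i + 3) + 2 ^ (i + 2) - 3 = 2 * 2 ^ (i + 2) + (2 ^ (i + 2) - 3) by
      rw [pow_succ 2 (i + 2)]; omega, sum_digits_two_shift _ _ _ (by omega)]
    have := sum_digits_two_compl (i + 2) (2 ^ (i + 2) - 3) 2 (by omega)
    have h2 : (Nat.digits 2 2).sum = 1 := by norm_num
    omega
  rw [hsum]
  refine le_sum_digits_two_of_mersenne_dvd _ _ (by omega) (Nat.mul_pos hk (by omega)) ?_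
  rw [hmul]
  exact Dvd.dvd.mul_left (Dvd.intro_left 3 rfl) k

/-- A number with binary representation `1 ^ r 0 1 ^ q 0 1 ^ p` is flimsy, apart from the listed
exceptions. -/
theorem flimsy_of_two_zeros (n p q r : ℕ) (hp : 0 < p) (hr : 0 < r)
    (hn : n + 1 + 2 ^ p + 2 ^ (p + q + 1) = 2 ^ (p + q + r + 2))
    (h11 : ¬ (p = 1 ∧ r = 1)) (h22 : ¬ (p = 2 ∧ q = 0 ∧ r = 2)) :
    ∃ k, 1 ≤ k ∧ (Nat.digits 2 (k * n)).sum < p + q + r := by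
  have hn' : n + (1 + 2 ^ p + 2 ^ (p + q + 1)) = 2 ^ (p + q + r + 2) := by omega
  have pow_ge : ∀ a b : ℕ, a ≤ b → (2 : ℕ) ^ a ≤ 2 ^ b := fun a b h =>
    Nat.pow_le_pow_right (by norm_num) h
  -- multiplication by `k + 1` works once `v = (k + 1) * w - 1` has enough binary digits `1`
  have key : ∀ k v : ℕ, v + 1 = (k + 1) * (1 + 2 ^ p + 2 ^ (p + q + 1)) →
      v + 1 ≤ 2 ^ (p + q + r + 2) → (Nat.digits 2 k).sum + 3 ≤ (Nat.digits 2 v).sum →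
      ∃ k, 1 ≤ k ∧ (Nat.digits 2 (k * n)).sum < p + q + r := by
    intro k v hv hle hs
    have := sum_digits_two_mul_of_add_eq_two_pow k n _ v _ hn' hv hle
    exact ⟨k + 1, by omega, by omega⟩
  rcases Nat.eq_zero_or_pos q with rfl | hq
  · simp only [add_zero] at *
    rcases Nat.lt_or_ge r 3 with hr3 | hr3
    · rcases Nat.lt_or_ge p 4 with hp4 | hp4
      · interval_cases r <;> interval_cases p <;> norm_num at hn <;> norm_num at h11 <;>
          norm_num at h22
        · obtain rfl : n = 19 := by omega
          exact ⟨27, by norm_num, by norm_num⟩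
        · obtain rfl : n = 39 := by omega
          exact ⟨7, by norm_num, by norm_num⟩
        · obtain rfl : n = 25 := by omega
          exact ⟨41, by norm_num, by norm_num⟩
        · obtain rfl : n = 103 := by omega
          exact ⟨5, by norm_num, by norm_num⟩
      · have h16 := pow_ge 4 p hp4
        interval_cases r
        · refine ⟨13, by norm_num, ?_⟩
          rw [show 13 * n = 64 * 2 ^ p + (2 ^ p - 13) by
            rw [pow_add, pow_add] at hn; omega,
            sum_digits_two_shift _ _ _ (by omega)]
          have := sum_digits_two_compl p (2 ^ p - 13) 12 (by omega)
          norm_num at this ⊢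
          omega
        · refine ⟨5, by norm_num, ?_⟩
          rw [show 5 * n = 64 * 2 ^ p + (2 ^ p - 5) by
            rw [add_assoc p 2 2, pow_add, pow_add] at hn; omega,
            sum_digits_two_shift _ _ _ (by omega)]
          have := sum_digits_two_compl p (2 ^ p - 5) 4 (by omega)
          norm_num at this ⊢
          omega
    · rcases Nat.lt_or_ge p 3 with hp3 | hp3
      · interval_cases p
        · refine key 8 62 (by norm_num) ?_ (by norm_num)
          have := pow_ge 6 (1 + r + 2) (by omega)
          omega
        · refine key 8 116 (by norm_num) ?_ (by norm_num)
          have := pow_ge 7 (2 + r + 2) (by omega)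
          omega
      · have h8 := pow_ge 3 p hp3
        refine key 6 (21 * 2 ^ p + 6) (by ring) ?_ ?_
        · have := pow_ge (p + 5) (p + r + 2) (by omega)
          rw [pow_add] at this
          omega
        · rw [sum_digits_two_shift _ _ _ (by omega)]
          norm_num
  · rcases Nat.lt_or_ge p 2 with hp2 | hp2
    · obtain rfl : p = 1 := by omega
      rcases Nat.lt_or_ge q 2 with hq2 | hq2
      · obtain rfl : q = 1 := by omega
        refine key 4 54 (by norm_num) ?_ (by norm_num)
        have := pow_ge 6 (1 + 1 + r + 2) (by omega)
        omega
      · have h16 := pow_ge 4 (1 + q + 1) (by omega)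
        refine key 4 (5 * 2 ^ (1 + q + 1) + 14) (by ring) ?_ ?_
        · have := pow_ge (1 + q + 1 + 3) (1 + q + r + 2) (by omega)
          rw [pow_add _ _ 3] at this
          omega
        · rw [sum_digits_two_shift _ _ _ (by omega)]
          norm_num
    · have h4 := pow_ge 2 p hp2
      have hpq := pow_ge (p + 2) (p + q + 1) (by omega)
      rw [pow_add] at hpq
      refine key 2 (3 * 2 ^ (p + q + 1) + (3 * 2 ^ p + 2)) (by ring) ?_ ?_
      · have := pow_ge (p + q + 1 + 2) (p + q + r + 2) (by omega)
        rw [pow_add _ _ 2] at this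
        omega
      · rw [sum_digits_two_shift _ _ _ (by omega), sum_digits_two_shift _ _ _ (by omega)]
        norm_num

theorem stmt_12 (n : ℕ) (hn : 0 < n) (hodd : Odd n)
    (h0 : (Nat.digits 2 n).count 0 = 2) :
    (∀ k : ℕ, 1 ≤ k → (Nat.digits 2 n).sum ≤ (Nat.digits 2 (k * n)).sum) ↔
      (n = 51 ∨ ∃ i : ℕ, n = 2 ^ (i + 3) + 2 ^ (i + 2) - 3) := by
  constructor
  · intro hsturdy
    obtain ⟨p, q, r, hr, h, hsum⟩ := exists_of_count_zero_eq_two n h0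
    have hp : 0 < p := by
      rcases Nat.eq_zero_or_pos p with rfl | hp
      · obtain ⟨m, rfl⟩ := hodd
        rw [pow_succ 2 (0 + q), pow_succ 2 (0 + q + r + 1)] at h
        omega
      · exact hp
    by_cases h11 : p = 1 ∧ r = 1
    · obtain ⟨rfl, rfl⟩ := h11
      refine Or.inr ⟨q, ?_⟩
      rw [show 1 + q + 1 + 2 = (q + 2) + 2 by ring, show 1 + q + 1 = q + 2 by ring,
        pow_add 2 (q + 2) 2] at h
      rw [pow_succ 2 (q + 2)]
      omega
    by_cases h22 : p = 2 ∧ q = 0 ∧ r = 2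
    · obtain ⟨rfl, rfl, rfl⟩ := h22
      norm_num at h
      exact Or.inl (by omega)
    obtain ⟨k, hk, hlt⟩ := flimsy_of_two_zeros n p q r hp hr h h11 h22
    have := hsturdy k hk
    omega
  · rintro (rfl | ⟨i, rfl⟩) k hk
    · have h := minDigitSumModFiftyOne_le (k * 51) (by omega)
      rw [Nat.mul_mod_left] at h
      exact le_trans (by decide) h
    · exact sturdy_three_mul_mersenne i k hk
end
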